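/- For each 0 ≤ k ≤ n, the subalgebra D_k of ℂR_n spanned by {⌊s⌋ : rk(s) = k} is isomorphic as a ℂ-algebra to the algebra M_{(n choose k)}(ℂS_k) of (n choose k)×(n choose k) matrices over the group algebra of the symmetric group S_k; hence ℂR_n ≅ ⨁_{k=0}^n M_{(n choose k)}(ℂS_k). -/

import Mathlib

open Finset

/-- The rook monoid structure on partial permutations: maps act on the left, so
`s * t = s ∘ t`. -/
instance rookMonoid (n : ℕ) : Monoid (Fin n ≃. Fin n) where
  mul s t := t.trans s
  mul_assoc s t u := (PEquiv.trans_assoc u t s).symm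
  one := PEquiv.refl _
  one_mul s := PEquiv.trans_refl s
  mul_one s := PEquiv.refl_trans s

/-- The restriction order on partial permutations. -/
def rookLe {n : ℕ} (s t : Fin n ≃. Fin n) : Prop :=
  ∀ x, s x = none ∨ s x = t x

instance {n : ℕ} (s t : Fin n ≃. Fin n) : Decidable (rookLe s t) :=
  inferInstanceAs (Decidable (∀ x, s x = none ∨ s x = t x))

/-- The rank of a partial permutation: the size of its domain. -/
def rookRk {n : ℕ} (s : Fin n ≃. Fin n) : ℕ :=
  (Finset.univ.filter fun x => (s x).isSome).card

/-- The domain of a partial permutation. -/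
def rookDom {n : ℕ} (s : Fin n ≃. Fin n) : Set (Fin n) := {x | s x ≠ none}

/-- The range of a partial permutation. -/
def rookRan {n : ℕ} (s : Fin n ≃. Fin n) : Set (Fin n) := {y | s.symm y ≠ none}

noncomputable instance {n : ℕ} : Fintype (Fin n ≃. Fin n) :=
  Fintype.ofInjective (fun f => (f : Fin n → Option (Fin n))) DFunLike.coe_injective

/-- The groupoid-basis element `⌊s⌋ = ∑_{t ≤ s} (−1)^{rk(s) − rk(t)} t` of the
semigroup algebra `ℂ R_n`. -/
noncomputable def rookBr {n : ℕ} (s : Fin n ≃. Fin n) :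
    MonoidAlgebra ℂ (Fin n ≃. Fin n) :=
  ∑ t ∈ Finset.univ.filter (fun t => rookLe t s),
    ((-1 : ℂ) ^ (rookRk s - rookRk t)) • MonoidAlgebra.single t 1

/-- `D_k`: the span in `ℂ R_n` of the groupoid basis elements `⌊s⌋` with `rk(s) = k`. -/
noncomputable def rookD (n k : ℕ) : Submodule ℂ (MonoidAlgebra ℂ (Fin n ≃. Fin n)) :=
  Submodule.span ℂ {x | ∃ s : Fin n ≃. Fin n, rookRk s = k ∧ x = rookBr s}



/-- The `i`-th order embedding `Fin k → Fin n` (enumeration of the `k`-subsets). -/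
noncomputable def rookIota (n k : ℕ) (i : Fin (n.choose k)) : Fin k ↪o Fin n :=
  (((Finset.equivFinOfCardEq (s := Finset.powersetCard k (Finset.univ : Finset (Fin n)))
    (by simp)).symm i).1).orderEmbOfFin
    (Finset.mem_powersetCard.1 ((Finset.equivFinOfCardEq
      (s := Finset.powersetCard k (Finset.univ : Finset (Fin n))) (by simp)).symm i).2).2

theorem rookIota_range_inj {n k : ℕ} {i j : Fin (n.choose k)}
    (h : Set.range (rookIota n k i) = Set.range (rookIota n k j)) : i = j := by
  unfold rookIota at h
  rw [Finset.range_orderEmbOfFin, Finset.range_orderEmbOfFin] at h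
  exact (Equiv.injective _) (Subtype.ext (Finset.coe_injective h))

theorem rookIota_range_surj {n k : ℕ} (A : Finset (Fin n)) (hA : A.card = k) :
    ∃ i, Set.range (rookIota n k i) = A := by
  have hm : A ∈ Finset.powersetCard k (Finset.univ : Finset (Fin n)) := by simp [hA]
  refine ⟨Finset.equivFinOfCardEq
      (s := Finset.powersetCard k (Finset.univ : Finset (Fin n))) (by simp) ⟨A, hm⟩, ?_⟩
  unfold rookIota
  rw [Finset.range_orderEmbOfFin, Equiv.symm_apply_apply]

theorem rookIota_factor {n k : ℕ} (f : Fin k → Fin n) (hf : Function.Injective f) :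
    ∃ (i : Fin (n.choose k)) (σ : Equiv.Perm (Fin k)), ∀ x, f x = rookIota n k i (σ x) := by
  obtain ⟨i, hi⟩ := rookIota_range_surj (n := n) (k := k) (Finset.univ.image f)
    (by rw [Finset.card_image_of_injective _ hf]; simp)
  have h : ∀ x, ∃ y, rookIota n k i y = f x := by
    intro x
    have : f x ∈ Set.range (rookIota n k i) := by rw [hi]; simp
    exact this
  choose g hg using h
  have hgi : Function.Injective g := by
    intro a b hab
    apply hf
    rw [← hg, ← hg, hab]
  exact ⟨i, Equiv.ofBijective g (Finite.injective_iff_bijective.1 hgi), fun x => (hg x).symm⟩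

theorem rookIota_unique {n k : ℕ} {i j : Fin (n.choose k)} {σ τ : Equiv.Perm (Fin k)}
    (h : ∀ x, rookIota n k i (σ x) = rookIota n k j (τ x)) : i = j ∧ σ = τ := by
  have hij : i = j := by
    apply rookIota_range_inj
    have h1 := σ.surjective.range_comp (rookIota n k i)
    have h2 := τ.surjective.range_comp (rookIota n k j)
    rw [← h1, ← h2]
    congr 1
    funext x
    exact h x
  subst hij
  exact ⟨rfl, Equiv.ext fun x => (rookIota n k i).injective (h x)⟩

/-- `s` maps the `j`-th subset onto the `i`-th, inducing `σ`. -/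
def rookP {n k : ℕ} (s : Fin n ≃. Fin n) (i j : Fin (n.choose k)) (σ : Equiv.Perm (Fin k)) :
    Prop := ∀ x, s (rookIota n k j x) = some (rookIota n k i (σ x))

theorem rookP_unique {n k : ℕ} {s : Fin n ≃. Fin n} {i i' j : Fin (n.choose k)}
    {σ σ' : Equiv.Perm (Fin k)} (h : rookP s i j σ) (h' : rookP s i' j σ') :
    i = i' ∧ σ = σ' := by
  apply rookIota_unique
  intro x
  exact Option.some_injective _ ((h x).symm.trans (h' x))

theorem rookP_comp {n k : ℕ} {s t : Fin n ≃. Fin n} {i l j : Fin (n.choose k)}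
    {σ τ : Equiv.Perm (Fin k)} (hs : rookP s i l σ) (ht : rookP t l j τ) :
    rookP (s * t) i j (σ * τ) := by
  intro x
  change (t.trans s) _ = _
  rw [PEquiv.trans_eq_some]
  exact ⟨_, ht x, hs _⟩

theorem rookP_decomp {n k : ℕ} {s t : Fin n ≃. Fin n} {i j : Fin (n.choose k)}
    {σ : Equiv.Perm (Fin k)} (h : rookP (s * t) i j σ) :
    ∃ l τ ρ, rookP s i l ρ ∧ rookP t l j τ ∧ ρ * τ = σ := by
  have h' : ∀ x, ∃ b, t (rookIota n k j x) = some b ∧ s b = some (rookIota n k i (σ x)) := by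
    intro x
    exact (PEquiv.trans_eq_some t s _ _).1 (h x)
  choose f hf1 hf2 using h'
  have hfi : Function.Injective f := by
    intro a b hab
    apply (rookIota n k j).injective
    exact t.inj (hf1 a) (by rw [hab]; exact hf1 b)
  obtain ⟨l, τ, hl⟩ := rookIota_factor f hfi
  refine ⟨l, τ, σ * τ⁻¹, ?_, ?_, by simp⟩
  · intro x
    have := hf2 (τ⁻¹ x)
    rw [hl] at this
    simpa using this
  · intro x
    rw [hf1, hl]

theorem rookP_one {n k : ℕ} {i j : Fin (n.choose k)} {σ : Equiv.Perm (Fin k)} :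
    rookP (1 : Fin n ≃. Fin n) i j σ ↔ i = j ∧ σ = 1 := by
  constructor
  · intro h
    have := rookIota_unique (i := i) (j := j) (σ := σ) (τ := 1)
      (fun x => (Option.some_injective _ (h x)).symm)
    exact this
  · rintro ⟨rfl, rfl⟩ x
    rfl

/-- An injective map as a partial equivalence. -/
noncomputable def rookEmb {α β : Type*} (f : α → β) (hf : Function.Injective f) : α ≃. β where
  toFun a := some (f a)
  invFun := Function.partialInv f
  inv a b := by
    have := hf.isPartialInv a b
    change Function.partialInv f b = some a ↔ some (f a) = some b
    rw [this]
    simp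

/-- The partial permutation attached to a matrix unit. -/
noncomputable def rookR {n k : ℕ} (i j : Fin (n.choose k)) (σ : Equiv.Perm (Fin k)) :
    Fin n ≃. Fin n :=
  (rookEmb (rookIota n k j) (rookIota n k j).injective).symm.trans
    (rookEmb (fun x => rookIota n k i (σ x)) ((rookIota n k i).injective.comp σ.injective))

theorem rookR_eq_some {n k : ℕ} (i j : Fin (n.choose k)) (σ : Equiv.Perm (Fin k)) (x y : Fin n) :
    rookR i j σ x = some y ↔ ∃ a, rookIota n k j a = x ∧ rookIota n k i (σ a) = y := by
  unfold rookR
  rw [PEquiv.trans_eq_some]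
  simp only [PEquiv.eq_some_iff]
  simp [rookEmb]

theorem rookLe_iff {n : ℕ} {s t : Fin n ≃. Fin n} :
    rookLe s t ↔ ∀ x y, s x = some y → t x = some y := by
  unfold rookLe
  constructor
  · intro h x y hy
    rcases h x with h | h
    · simp [h] at hy
    · rw [← h, hy]
  · intro h x
    rcases hx : s x with _ | y
    · simp
    · right
      exact (h x y hx).symm

theorem rookR_le {n k : ℕ} {i j : Fin (n.choose k)} {σ : Equiv.Perm (Fin k)}
    {s : Fin n ≃. Fin n} : rookLe (rookR i j σ) s ↔ rookP s i j σ := by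
  rw [rookLe_iff]
  simp only [rookR_eq_some]
  constructor
  · intro h x
    exact h _ _ ⟨x, rfl, rfl⟩
  · rintro h x y ⟨a, rfl, rfl⟩
    exact h a

/-- The domain as a finset. -/
def rookDm {n : ℕ} (s : Fin n ≃. Fin n) : Finset (Fin n) :=
  Finset.univ.filter fun x => (s x).isSome

theorem mem_rookDm {n : ℕ} {s : Fin n ≃. Fin n} {x : Fin n} :
    x ∈ rookDm s ↔ ∃ y, s x = some y := by
  simp [rookDm, Option.isSome_iff_exists]

theorem rookDm_rookR {n k : ℕ} (i j : Fin (n.choose k)) (σ : Equiv.Perm (Fin k)) :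
    (rookDm (rookR i j σ) : Set (Fin n)) = Set.range (rookIota n k j) := by
  ext x
  rw [Finset.mem_coe, mem_rookDm]
  simp only [rookR_eq_some]
  constructor
  · rintro ⟨y, a, ha, -⟩
    exact ⟨a, ha⟩
  · rintro ⟨a, ha⟩
    exact ⟨_, a, ha, rfl⟩

theorem rookRk_rookR {n k : ℕ} (i j : Fin (n.choose k)) (σ : Equiv.Perm (Fin k)) :
    rookRk (rookR i j σ) = k := by
  change (rookDm _).card = k
  rw [← Set.ncard_coe_finset, rookDm_rookR, ← Set.image_univ,
    Set.ncard_image_of_injective _ (rookIota n k j).injective]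
  simp

theorem rookR_inj {n k : ℕ} {i j i' j' : Fin (n.choose k)} {σ σ' : Equiv.Perm (Fin k)}
    (h : rookR i j σ = rookR i' j' σ') : i = i' ∧ j = j' ∧ σ = σ' := by
  have hj : j = j' := by
    apply rookIota_range_inj
    rw [← rookDm_rookR i j σ, ← rookDm_rookR i' j' σ', h]
  subst hj
  have h1 : rookP (rookR i j σ) i j σ := rookR_le.1 fun x => Or.inr rfl
  have h2 : rookP (rookR i j σ) i' j σ' := by rw [h]; exact rookR_le.1 fun x => Or.inr rfl
  have := rookP_unique h1 h2
  exact ⟨this.1, rfl, this.2⟩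

theorem rookR_surj {n k : ℕ} (s : Fin n ≃. Fin n) (hs : rookRk s = k) :
    ∃ (i j : Fin (n.choose k)) (σ : Equiv.Perm (Fin k)), rookR i j σ = s := by
  obtain ⟨j, hj⟩ := rookIota_range_surj (rookDm s) hs
  have h : ∀ x, ∃ y, s (rookIota n k j x) = some y := by
    intro x
    rw [← mem_rookDm, ← Finset.mem_coe, ← hj]
    exact ⟨x, rfl⟩
  choose f hf using h
  have hfi : Function.Injective f := by
    intro a b hab
    apply (rookIota n k j).injective
    exact s.inj (hf a) (by rw [hab]; exact hf b)
  obtain ⟨i, σ, hl⟩ := rookIota_factor f hfi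
  refine ⟨i, j, σ, ?_⟩
  have hle : rookLe (rookR i j σ) s := rookR_le.2 fun x => by rw [hf, hl]
  ext1 x
  rcases hle x with h | h
  · rw [h]
    by_contra hne
    have : x ∈ rookDm s := by
      rw [mem_rookDm]
      exact Option.ne_none_iff_exists'.1 (fun h => hne h.symm)
    rw [← Finset.mem_coe, ← hj, ← rookDm_rookR i j σ, Finset.mem_coe, mem_rookDm] at this
    simp [h] at this
  · exact h

theorem rookLe_dm {n : ℕ} {s t : Fin n ≃. Fin n} (h : rookLe s t) : rookDm s ⊆ rookDm t := by
  intro x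
  rw [mem_rookDm, mem_rookDm]
  rintro ⟨y, hy⟩
  exact ⟨y, rookLe_iff.1 h _ _ hy⟩

theorem rookLe_ext {n : ℕ} {s t u : Fin n ≃. Fin n} (h : rookLe s u) (h' : rookLe t u)
    (hd : rookDm s ⊆ rookDm t) : rookLe s t := by
  rw [rookLe_iff] at *
  intro x y hy
  obtain ⟨z, hz⟩ := mem_rookDm.1 (hd (mem_rookDm.2 ⟨y, hy⟩))
  rw [hz, ← h' _ _ hz, h _ _ hy]

theorem rookLe_antisymm {n : ℕ} {s t : Fin n ≃. Fin n} (h : rookLe s t) (h' : rookLe t s) :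
    s = t := by
  ext1 x
  rcases h x with h1 | h1
  · rcases h' x with h2 | h2
    · rw [h1, h2]
    · exact h2.symm
  · exact h1

/-- Restriction of a partial permutation to a finset. -/
noncomputable def rookRes {n : ℕ} (s : Fin n ≃. Fin n) (X : Finset (Fin n)) : Fin n ≃. Fin n :=
  (PEquiv.ofSet (X : Set (Fin n))).trans s

theorem rookRes_eq_some {n : ℕ} (s : Fin n ≃. Fin n) (X : Finset (Fin n)) (x y : Fin n) :
    rookRes s X x = some y ↔ x ∈ X ∧ s x = some y := by
  unfold rookRes
  rw [PEquiv.trans_eq_some]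
  simp [PEquiv.ofSet, and_assoc]

theorem rookRes_le {n : ℕ} (s : Fin n ≃. Fin n) (X : Finset (Fin n)) :
    rookLe (rookRes s X) s := by
  rw [rookLe_iff]
  intro x y h
  exact ((rookRes_eq_some _ _ _ _).1 h).2

theorem rookRes_dm {n : ℕ} (s : Fin n ≃. Fin n) (X : Finset (Fin n)) (hX : X ⊆ rookDm s) :
    rookDm (rookRes s X) = X := by
  ext x
  rw [mem_rookDm]
  simp only [rookRes_eq_some]
  constructor
  · rintro ⟨y, h, -⟩
    exact h
  · intro h
    obtain ⟨y, hy⟩ := mem_rookDm.1 (hX h)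
    exact ⟨y, h, hy⟩

theorem rook_moebius {n : ℕ} (u s : Fin n ≃. Fin n) :
    (∑ t ∈ Finset.univ.filter (fun t => rookLe t s),
      ((-1 : ℂ) ^ (rookRk s - rookRk t)) * (if rookLe u t then 1 else 0)) =
      if u = s then 1 else 0 := by
  classical
  by_cases hus : rookLe u s
  · simp only [mul_ite, mul_one, mul_zero]
    rw [← Finset.sum_filter, Finset.filter_filter]
    have key : (∑ t ∈ Finset.univ.filter (fun t => rookLe t s ∧ rookLe u t),
        ((-1 : ℂ) ^ (rookRk s - rookRk t))) =
        ∑ Y ∈ (rookDm s \ rookDm u).powerset, (-1 : ℂ) ^ Y.card := by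
      refine Finset.sum_bij' (fun t _ => rookDm s \ rookDm t)
        (fun Y _ => rookRes s (rookDm s \ Y)) ?_ ?_ ?_ ?_ ?_
      · intro t ht
        simp only [Finset.mem_filter, Finset.mem_univ, true_and] at ht
        rw [Finset.mem_powerset]
        exact Finset.sdiff_subset_sdiff subset_rfl (rookLe_dm ht.2)
      · intro Y hY
        rw [Finset.mem_powerset] at hY
        simp only [Finset.mem_filter, Finset.mem_univ, true_and]
        refine ⟨rookRes_le _ _, rookLe_ext hus (rookRes_le _ _) ?_⟩
        rw [rookRes_dm _ _ Finset.sdiff_subset]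
        intro x hx
        rw [Finset.mem_sdiff]
        exact ⟨rookLe_dm hus hx, fun h => (Finset.mem_sdiff.1 (hY h)).2 hx⟩
      · intro t ht
        simp only [Finset.mem_filter, Finset.mem_univ, true_and] at ht
        have hd : rookDm (rookRes s (rookDm s \ (rookDm s \ rookDm t))) = rookDm t := by
          rw [rookRes_dm _ _ Finset.sdiff_subset, Finset.sdiff_sdiff_eq_self (rookLe_dm ht.1)]
        exact rookLe_antisymm (rookLe_ext (rookRes_le _ _) ht.1 hd.le)
          (rookLe_ext ht.1 (rookRes_le _ _) hd.ge)
      · intro Y hY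
        rw [Finset.mem_powerset] at hY
        rw [rookRes_dm _ _ Finset.sdiff_subset,
          Finset.sdiff_sdiff_eq_self (hY.trans Finset.sdiff_subset)]
      · intro t ht
        simp only [Finset.mem_filter, Finset.mem_univ, true_and] at ht
        rw [Finset.card_sdiff_of_subset (rookLe_dm ht.1)]
        rfl
    rw [key]
    have h2 := congrArg (Int.cast : ℤ → ℂ)
      (Finset.sum_powerset_neg_one_pow_card (x := rookDm s \ rookDm u))
    push_cast at h2
    rw [h2]
    have h3 : rookDm s \ rookDm u = ∅ ↔ u = s := by
      rw [Finset.sdiff_eq_empty_iff_subset]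
      constructor
      · intro h
        exact rookLe_antisymm hus (rookLe_ext (fun x => Or.inr rfl) hus h)
      · rintro rfl
        exact subset_rfl
    simp [h3]
  · have hne : u ≠ s := by
      rintro rfl
      exact hus fun x => Or.inr rfl
    rw [if_neg hne]
    apply Finset.sum_eq_zero
    intro t ht
    simp only [Finset.mem_filter, Finset.mem_univ, true_and] at ht
    rw [if_neg, mul_zero]
    intro h
    exact hus (rookLe_iff.2 fun x y hy => rookLe_iff.1 ht _ _ (rookLe_iff.1 h _ _ hy))

open Classical in
/-- The matrix of a partial permutation acting on `k`-subsets. -/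
noncomputable def rookM {n : ℕ} (k : ℕ) (s : Fin n ≃. Fin n) :
    Matrix (Fin (n.choose k)) (Fin (n.choose k)) (MonoidAlgebra ℂ (Equiv.Perm (Fin k))) :=
  Matrix.of fun i j => ∑ σ, if rookP s i j σ then MonoidAlgebra.single σ 1 else 0

theorem rookM_of {n k : ℕ} {s : Fin n ≃. Fin n} {i j : Fin (n.choose k)}
    {σ : Equiv.Perm (Fin k)} (h : rookP s i j σ) :
    rookM k s i j = MonoidAlgebra.single σ 1 := by
  classical
  simp only [rookM, Matrix.of_apply]
  rw [Finset.sum_eq_single σ]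
  · rw [if_pos h]
  · intro τ _ hτ
    rw [if_neg]
    intro h'
    exact hτ (rookP_unique h' h).2
  · simp

theorem rookM_zero {n k : ℕ} {s : Fin n ≃. Fin n} {i j : Fin (n.choose k)}
    (h : ∀ σ, ¬ rookP s i j σ) : rookM k s i j = 0 := by
  classical
  simp only [rookM, Matrix.of_apply]
  exact Finset.sum_eq_zero fun σ _ => if_neg (h σ)

theorem rookM_one {n : ℕ} (k : ℕ) : rookM k (1 : Fin n ≃. Fin n) = 1 := by
  ext1 i j
  by_cases hij : i = j
  · rw [rookM_of (rookP_one.2 ⟨hij, rfl⟩), hij, Matrix.one_apply_eq]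
    rfl
  · rw [rookM_zero, Matrix.one_apply_ne hij]
    intro σ h
    exact hij (rookP_one.1 h).1

theorem rookM_mul {n : ℕ} (k : ℕ) (s t : Fin n ≃. Fin n) :
    rookM k (s * t) = rookM k s * rookM k t := by
  ext1 i j
  rw [Matrix.mul_apply]
  by_cases hex : ∃ σ, rookP (s * t) i j σ
  · obtain ⟨σ, h⟩ := hex
    obtain ⟨l, τ, ρ, hs, ht, rfl⟩ := rookP_decomp h
    rw [rookM_of h, Finset.sum_eq_single l, rookM_of hs, rookM_of ht,
      MonoidAlgebra.single_mul_single, one_mul]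
    · intro m _ hm
      rw [rookM_zero (s := t), mul_zero]
      intro τ' h'
      exact hm (rookP_unique h' ht).1
    · simp
  · push Not at hex
    rw [rookM_zero hex]
    symm
    apply Finset.sum_eq_zero
    intro l _
    by_cases h1 : ∃ ρ, rookP s i l ρ
    · obtain ⟨ρ, hρ⟩ := h1
      rw [rookM_zero (s := t), mul_zero]
      intro τ hτ
      exact hex _ (rookP_comp hρ hτ)
    · push Not at h1
      rw [rookM_zero h1, zero_mul]

/-- The algebra map from the rook algebra to the `k`-th matrix algebra. -/
noncomputable def rookPhi (n k : ℕ) : MonoidAlgebra ℂ (Fin n ≃. Fin n) →ₐ[ℂ]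
    Matrix (Fin (n.choose k)) (Fin (n.choose k)) (MonoidAlgebra ℂ (Equiv.Perm (Fin k))) :=
  MonoidAlgebra.lift ℂ _ _
    { toFun := rookM k, map_one' := rookM_one k, map_mul' := rookM_mul k }

theorem rookPhi_single {n k : ℕ} (s : Fin n ≃. Fin n) :
    rookPhi n k (MonoidAlgebra.single s 1) = rookM k s := by
  simp [rookPhi]

open Classical in
theorem rookPhi_br {n k : ℕ} (s : Fin n ≃. Fin n) (i j : Fin (n.choose k)) :
    rookPhi n k (rookBr s) i j =
      ∑ σ, if rookR i j σ = s then MonoidAlgebra.single σ 1 else 0 := by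
  unfold rookBr
  simp only [map_sum, map_smul, rookPhi_single, Matrix.sum_apply, Matrix.smul_apply]
  simp only [rookM, Matrix.of_apply, Finset.smul_sum]
  rw [Finset.sum_comm]
  refine Finset.sum_congr rfl fun σ _ => ?_
  have h := congrArg (fun c : ℂ => c • (MonoidAlgebra.single σ 1 :
    MonoidAlgebra ℂ (Equiv.Perm (Fin k)))) (rook_moebius (rookR i j σ) s)
  simp only [Finset.sum_smul, ite_smul, one_smul, zero_smul] at h
  rw [← h]
  refine Finset.sum_congr rfl fun t _ => ?_
  simp only [rookR_le]
  by_cases hp : rookP t i j σ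
  · simp [hp]
  · simp [hp]

theorem rookPhi_br_ne {n k : ℕ} (s : Fin n ≃. Fin n) (hs : rookRk s ≠ k) :
    rookPhi n k (rookBr s) = 0 := by
  classical
  ext1 i j
  rw [rookPhi_br]
  apply Finset.sum_eq_zero
  intro σ _
  rw [if_neg]
  rintro rfl
  exact hs (rookRk_rookR i j σ)

theorem rookPhi_br_R {n k : ℕ} (i j : Fin (n.choose k)) (σ : Equiv.Perm (Fin k)) :
    rookPhi n k (rookBr (rookR i j σ)) = Matrix.single i j (MonoidAlgebra.single σ 1) := by
  classical
  ext1 a b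
  rw [rookPhi_br]
  by_cases hab : i = a ∧ j = b
  · obtain ⟨rfl, rfl⟩ := hab
    rw [Matrix.single_apply_same, Finset.sum_eq_single σ]
    · rw [if_pos rfl]
    · intro τ _ hτ
      rw [if_neg]
      intro h
      exact hτ (rookR_inj h).2.2
    · simp
  · rw [Matrix.single_apply_of_ne _ _ _ _ _ hab]
    apply Finset.sum_eq_zero
    intro τ _
    rw [if_neg]
    intro h
    exact hab ⟨(rookR_inj h).1.symm, (rookR_inj h).2.1.symm⟩

theorem rook_span_matrix {m G : Type*} [Fintype m] [DecidableEq m]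
    (W : Submodule ℂ (Matrix m m (MonoidAlgebra ℂ G)))
    (h : ∀ i j σ, Matrix.single i j (MonoidAlgebra.single σ 1) ∈ W)
    (x : Matrix m m (MonoidAlgebra ℂ G)) : x ∈ W := by
  rw [Matrix.matrix_eq_sum_single x]
  refine W.sum_mem fun i _ => W.sum_mem fun j _ => ?_
  have hx : ∀ y : MonoidAlgebra ℂ G, Matrix.single i j y ∈ W := by
    intro y
    have h1 : (⊤ : Submodule ℂ (MonoidAlgebra ℂ G)) ≤ W.comap (Matrix.singleLinearMap ℂ i j) := by
      rw [← (MonoidAlgebra.basis G ℂ).span_eq, Submodule.span_le]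
      rintro _ ⟨σ, rfl⟩
      simpa using h i j σ
    exact h1 (Submodule.mem_top (x := y))
  exact hx _

/-- The restriction to `D_k` hits everything. -/
theorem rookPhi_surj_D {n k : ℕ}
    (x : Matrix (Fin (n.choose k)) (Fin (n.choose k)) (MonoidAlgebra ℂ (Equiv.Perm (Fin k)))) :
    ∃ y ∈ rookD n k, rookPhi n k y = x := by
  have := rook_span_matrix ((rookD n k).map (rookPhi n k).toLinearMap) (fun i j σ =>
    ⟨rookBr (rookR i j σ), Submodule.subset_span ⟨_, rookRk_rookR i j σ, rfl⟩,
      rookPhi_br_R i j σ⟩) x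
  exact this

theorem rookPhi_D_ne {n k l : ℕ} (hkl : k ≠ l) (x : MonoidAlgebra ℂ (Fin n ≃. Fin n))
    (hx : x ∈ rookD n k) : rookPhi n l x = 0 := by
  have : rookD n k ≤ LinearMap.ker (rookPhi n l).toLinearMap := by
    unfold rookD
    rw [Submodule.span_le]
    rintro _ ⟨s, hs, rfl⟩
    exact rookPhi_br_ne s (by rw [hs]; exact hkl)
  exact this hx

/-- The algebra map to the product of the matrix algebras. -/
noncomputable def rookPsi (n : ℕ) : MonoidAlgebra ℂ (Fin n ≃. Fin n) →ₐ[ℂ]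
    (∀ k : Fin (n + 1), Matrix (Fin (n.choose k)) (Fin (n.choose k))
      (MonoidAlgebra ℂ (Equiv.Perm (Fin k)))) :=
  AlgHom.pi fun k => rookPhi n k

theorem rookPsi_surj (n : ℕ) : Function.Surjective (rookPsi n) := by
  intro x
  choose y hy hy2 using fun k : Fin (n + 1) => rookPhi_surj_D (x k)
  refine ⟨∑ k, y k, ?_⟩
  funext l
  change rookPhi n l (∑ k, y k) = x l
  rw [map_sum, Finset.sum_eq_single l]
  · exact hy2 l
  · intro k _ hk
    exact rookPhi_D_ne (fun h => hk (Fin.ext h)) _ (hy k)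
  · simp

theorem rookRk_le {n : ℕ} (s : Fin n ≃. Fin n) : rookRk s ≤ n := by
  have h : (rookDm s).card ≤ n := by simpa using Finset.card_le_univ (rookDm s)
  exact h

theorem rook_card_le (n : ℕ) : Fintype.card (Fin n ≃. Fin n) ≤
    ∑ k : Fin (n + 1), n.choose k * n.choose k * (k : ℕ).factorial := by
  have h := Fintype.card_le_of_surjective
    (fun q : (Σ k : Fin (n + 1),
      (Fin (n.choose k) × Fin (n.choose k)) × Equiv.Perm (Fin k)) =>
      (rookR q.2.1.1 q.2.1.2 q.2.2 : Fin n ≃. Fin n)) (by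
    intro s
    obtain ⟨i, j, σ, h⟩ := rookR_surj (k := rookRk s) s rfl
    exact ⟨⟨⟨rookRk s, Nat.lt_succ_of_le (rookRk_le s)⟩, (i, j), σ⟩, h⟩)
  simpa [Fintype.card_perm] using h

theorem rookPsi_inj (n : ℕ) : Function.Injective (rookPsi n) := by
  haveI : Module.Finite ℂ (MonoidAlgebra ℂ (Fin n ≃. Fin n)) :=
    Module.Finite.of_basis (MonoidAlgebra.basis _ ℂ)
  haveI : ∀ k : ℕ, Module.Finite ℂ (MonoidAlgebra ℂ (Equiv.Perm (Fin k))) := fun k =>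
    Module.Finite.of_basis (MonoidAlgebra.basis _ ℂ)
  have h1 : Module.finrank ℂ (∀ k : Fin (n + 1),
      Matrix (Fin (n.choose k)) (Fin (n.choose k)) (MonoidAlgebra ℂ (Equiv.Perm (Fin k)))) =
      ∑ k : Fin (n + 1), n.choose k * n.choose k * (k : ℕ).factorial := by
    rw [Module.finrank_pi_fintype]
    refine Finset.sum_congr rfl fun k _ => ?_
    rw [Module.finrank_matrix, Module.finrank_eq_card_basis (MonoidAlgebra.basis _ ℂ)]
    simp [Fintype.card_perm]
  have h2 : Module.finrank ℂ (MonoidAlgebra ℂ (Fin n ≃. Fin n)) =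
      Fintype.card (Fin n ≃. Fin n) :=
    Module.finrank_eq_card_basis (MonoidAlgebra.basis _ ℂ)
  have h3 := LinearMap.finrank_range_add_finrank_ker (rookPsi n).toLinearMap
  have hs : LinearMap.range (rookPsi n).toLinearMap = ⊤ :=
    LinearMap.range_eq_top.2 (rookPsi_surj n)
  rw [hs, finrank_top, h1, h2] at h3
  have h4 : Module.finrank ℂ (LinearMap.ker (rookPsi n).toLinearMap) = 0 := by
    have := rook_card_le n
    omega
  have h5 := Submodule.finrank_eq_zero.1 h4
  exact LinearMap.ker_eq_bot.1 h5

/-- Steinberg's decomposition: for each `0 ≤ k ≤ n`, the subalgebra `D_k` of `ℂ R_n`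
spanned by `{⌊s⌋ : rk(s) = k}` is isomorphic as a `ℂ`-algebra (via a multiplicative
linear equivalence) to the `(n choose k) × (n choose k)` matrix algebra over the group
algebra `ℂ S_k`; hence `ℂ R_n ≅ ⨁_{k=0}^n M_{(n choose k)}(ℂ S_k)`. -/
theorem rook_monoid_matrix_algebra_decomposition (n : ℕ) :
    (∀ k : ℕ, k ≤ n →
      ∃ φ : rookD n k ≃ₗ[ℂ]
          Matrix (Fin (n.choose k)) (Fin (n.choose k)) (MonoidAlgebra ℂ (Equiv.Perm (Fin k))),
        ∀ (x y : rookD n k) (h : (x : MonoidAlgebra ℂ (Fin n ≃. Fin n)) * y ∈ rookD n k),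
          φ ⟨(x : MonoidAlgebra ℂ (Fin n ≃. Fin n)) * y, h⟩ = φ x * φ y) ∧
    Nonempty (MonoidAlgebra ℂ (Fin n ≃. Fin n) ≃ₐ[ℂ]
      ∀ k : Fin (n + 1),
        Matrix (Fin (n.choose k)) (Fin (n.choose k)) (MonoidAlgebra ℂ (Equiv.Perm (Fin k)))) := by
  refine ⟨?_, ⟨AlgEquiv.ofBijective (rookPsi n) ⟨rookPsi_inj n, rookPsi_surj n⟩⟩⟩
  intro k hk
  refine ⟨LinearEquiv.ofBijective ((rookPhi n k).toLinearMap.comp (rookD n k).subtype)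
    ⟨?_, ?_⟩, ?_⟩
  · rw [← LinearMap.ker_eq_bot, LinearMap.ker_eq_bot']
    intro x hx
    apply Subtype.ext
    apply rookPsi_inj n
    rw [Submodule.coe_zero, map_zero]
    funext l
    by_cases hl : k = l
    · subst hl
      exact hx
    · exact rookPhi_D_ne hl _ x.2
  · intro x
    obtain ⟨y, hy, h⟩ := rookPhi_surj_D x
    exact ⟨⟨y, hy⟩, h⟩
  · intro x y h
    exact map_mul (rookPhi n k) (x : MonoidAlgebra ℂ (Fin n ≃. Fin n)) y
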